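/- Let n ≥ 1, β ∈ ℕ with β ≥ 1, and let p, q, r ∈ [1, ∞] satisfy 1/r + 2β = (2β+1)/q. Then there exists a constant C > 0 such that for all Schwartz functions f ∈ 𝒮(ℝⁿ): ‖ |f|^{2β} f ‖_{M^{p,r}} ≤ C ‖f‖_{M^{p,q}}^{2β+1}. (Note that |f|^{2β} f = (f \bar{f})^β f is again a Schwartz function.) -/

import Mathlib

open scoped RealInnerProductSpace ENNReal
open MeasureTheory

noncomputable section

/-- Short-time Fourier transform on `ℝⁿ` with Gaussian window `φ(y) = e^{-|y|²}`. -/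
def STFT (n : ℕ) (f : EuclideanSpace ℝ (Fin n) → ℂ) (x ξ : EuclideanSpace ℝ (Fin n)) : ℂ :=
  ∫ y : EuclideanSpace ℝ (Fin n),
    f y * Complex.exp (-((‖y - x‖ ^ 2 : ℝ) : ℂ)) * Complex.exp (-Complex.I * (⟪y, ξ⟫ : ℝ))

/-- The `L^p` "norm" of an `ℝ≥0∞`-valued function, `essSup` when `p = ∞`. -/
def eLp {α : Type*} [MeasurableSpace α] (p : ℝ≥0∞) (μ : Measure α) (f : α → ℝ≥0∞) : ℝ≥0∞ :=
  if p = ∞ then essSup f μ else (∫⁻ a, f a ^ p.toReal ∂μ) ^ (1 / p.toReal)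

/-- The (unweighted) modulation norm `‖f‖_{M^{p,q}}` with Gaussian window. -/
def modNorm (n : ℕ) (p q : ℝ≥0∞) (f : EuclideanSpace ℝ (Fin n) → ℂ) : ℝ≥0∞ :=
  eLp q volume (fun ξ => eLp p volume (fun x => ENNReal.ofReal ‖STFT n f x ξ‖))

open Filter Topology

section Lebesgue

variable {X Y : Type*} [MeasurableSpace X] [MeasurableSpace Y] {μ : Measure X} {ν : Measure Y}

theorem eLp_of_ne_top {p : ℝ≥0∞} (hp : p ≠ ∞) (f : X → ℝ≥0∞) :
    eLp p μ f = (∫⁻ a, f a ^ p.toReal ∂μ) ^ (1 / p.toReal) := if_neg hp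

theorem eLp_top (f : X → ℝ≥0∞) : eLp ∞ μ f = essSup f μ := if_pos rfl

theorem eLp_mono {p : ℝ≥0∞} {f g : X → ℝ≥0∞} (h : ∀ x, f x ≤ g x) :
    eLp p μ f ≤ eLp p μ g := by
  unfold eLp
  split_ifs
  · exact essSup_mono_ae (Eventually.of_forall h)
  · gcongr with a
    exact h a

theorem eLp_const_mul {p : ℝ≥0∞} (hp : 1 ≤ p) {c : ℝ≥0∞} {f : X → ℝ≥0∞} (hf : Measurable f) :
    eLp p μ (fun x => c * f x) = c * eLp p μ f := by
  rcases eq_or_ne p ∞ with rfl | hp'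
  · rw [eLp_top, eLp_top, ENNReal.essSup_const_mul]
  · have h0 : 0 < p.toReal := ENNReal.toReal_pos (by positivity) hp'
    rw [eLp_of_ne_top hp', eLp_of_ne_top hp']
    simp_rw [ENNReal.mul_rpow_of_nonneg _ _ h0.le]
    rw [lintegral_const_mul _ (by fun_prop), ENNReal.mul_rpow_of_nonneg _ _ (by positivity),
      ← ENNReal.rpow_mul, mul_one_div_cancel h0.ne', ENNReal.rpow_one]

/-- Minkowski's integral inequality when the majorant is positive and has finite integral. -/
theorem lintegral_rpow_lintegral_le_of_pos [SFinite μ] [SFinite ν] {p : ℝ} (hp : 1 ≤ p)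
    {H : X → Y → ℝ≥0∞} (hH : Measurable (Function.uncurry H)) {w : Y → ℝ≥0∞} (hw : Measurable w)
    (hw0 : ∀ y, w y ≠ 0) (hwi : ∫⁻ y, w y ∂ν ≠ ∞)
    (hHw : ∀ y, (∫⁻ x, H x y ^ p ∂μ) ^ (1 / p) ≤ w y) :
    (∫⁻ x, (∫⁻ y, H x y ∂ν) ^ p ∂μ) ^ (1 / p) ≤ ∫⁻ y, w y ∂ν := by
  have hp0 : 0 < p := by linarith
  have hwt : ∀ᵐ y ∂ν, w y < ∞ := ae_lt_top hw hwi
  set W := ∫⁻ y, w y ∂ν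
  have hpt : ∀ x, (∫⁻ y, H x y ∂ν) ^ p ≤ (∫⁻ y, H x y ^ p * w y ^ (1 - p) ∂ν) * W ^ (p - 1) := by
    intro x
    have hHx : Measurable (H x) := hH.comp measurable_prodMk_left
    have h1 : ∫⁻ y, H x y ∂ν ≤
        (∫⁻ y, H x y ^ p * w y ^ (1 - p) ∂ν) ^ (1 / p) * W ^ (1 - 1 / p) := by
      refine le_trans (lintegral_mono_ae ?_) (ENNReal.lintegral_mul_norm_pow_le
        (f := fun y => H x y ^ p * w y ^ (1 - p)) (g := w)
        (by fun_prop) hw.aemeasurable (by positivity)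
        (sub_nonneg.2 ((div_le_one hp0).2 hp)) (by ring))
      filter_upwards [hwt] with y hy
      apply le_of_eq
      rw [ENNReal.mul_rpow_of_nonneg _ _ (by positivity), ← ENNReal.rpow_mul, ← ENNReal.rpow_mul,
        mul_one_div_cancel hp0.ne', ENNReal.rpow_one, mul_assoc,
        ← ENNReal.rpow_add _ _ (hw0 y) hy.ne]
      have : (1 - p) * (1 / p) + (1 - 1 / p) = 0 := by field_simp; ring
      rw [this, ENNReal.rpow_zero, mul_one]
    calc (∫⁻ y, H x y ∂ν) ^ p ≤ _ := ENNReal.rpow_le_rpow h1 hp0.le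
      _ = _ := by
        rw [ENNReal.mul_rpow_of_nonneg _ _ hp0.le, ← ENNReal.rpow_mul, ← ENNReal.rpow_mul,
          one_div_mul_cancel hp0.ne', ENNReal.rpow_one]
        congr 2
        field_simp
  have hmain : ∫⁻ x, (∫⁻ y, H x y ∂ν) ^ p ∂μ ≤ W ^ p := by
    calc ∫⁻ x, (∫⁻ y, H x y ∂ν) ^ p ∂μ
        ≤ ∫⁻ x, (∫⁻ y, H x y ^ p * w y ^ (1 - p) ∂ν) * W ^ (p - 1) ∂μ := lintegral_mono hpt
      _ = (∫⁻ x, ∫⁻ y, H x y ^ p * w y ^ (1 - p) ∂ν ∂μ) * W ^ (p - 1) := by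
        rw [lintegral_mul_const]
        exact Measurable.lintegral_prod_right'
          (f := fun z : X × Y => H z.1 z.2 ^ p * w z.2 ^ (1 - p))
          ((hH.pow_const p).mul ((hw.comp measurable_snd).pow_const _))
      _ = (∫⁻ y, (∫⁻ x, H x y ^ p ∂μ) * w y ^ (1 - p) ∂ν) * W ^ (p - 1) := by
        rw [lintegral_lintegral_swap]
        · congr 1
          refine lintegral_congr fun y => ?_
          rw [lintegral_mul_const]
          exact (hH.comp measurable_prodMk_right).pow_const p
        · exact ((hH.pow_const p).mul ((hw.comp measurable_snd).pow_const _)).aemeasurable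
      _ ≤ (∫⁻ y, w y ∂ν) * W ^ (p - 1) := by
        gcongr ?_ * _
        refine lintegral_mono_ae ?_
        filter_upwards [hwt] with y hy
        calc (∫⁻ x, H x y ^ p ∂μ) * w y ^ (1 - p) ≤ w y ^ p * w y ^ (1 - p) := by
              gcongr
              rw [← ENNReal.rpow_one (∫⁻ x, H x y ^ p ∂μ), ← one_div_mul_cancel hp0.ne',
                ENNReal.rpow_mul]
              exact ENNReal.rpow_le_rpow (hHw y) hp0.le
          _ = w y := by
              rw [← ENNReal.rpow_add _ _ (hw0 y) hy.ne, add_sub_cancel, ENNReal.rpow_one]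
      _ = W ^ p := by
        conv_lhs => rw [← ENNReal.rpow_one (∫⁻ y, w y ∂ν)]
        rw [← ENNReal.rpow_add_of_nonneg _ _ zero_le_one (by linarith), add_sub_cancel]
  calc _ ≤ (W ^ p) ^ (1 / p) := ENNReal.rpow_le_rpow hmain (by positivity)
    _ = W := by rw [← ENNReal.rpow_mul, mul_one_div_cancel hp0.ne', ENNReal.rpow_one]

/-- Minkowski's integral inequality. -/
theorem eLp_lintegral_le [SFinite μ] [SigmaFinite ν] {p : ℝ≥0∞} (hp : 1 ≤ p)
    {H : X → Y → ℝ≥0∞} (hH : Measurable (Function.uncurry H)) {w : Y → ℝ≥0∞} (hw : Measurable w)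
    (hHw : ∀ y, eLp p μ (fun x => H x y) ≤ w y) :
    eLp p μ (fun x => ∫⁻ y, H x y ∂ν) ≤ ∫⁻ y, w y ∂ν := by
  rcases eq_or_ne p ∞ with rfl | hp'
  · simp only [eLp_top] at hHw ⊢
    refine essSup_le_of_ae_le _ ?_
    have h1 : ∀ᵐ y ∂ν, ∀ᵐ x ∂μ, H x y ≤ w y :=
      Eventually.of_forall fun y => (ENNReal.ae_le_essSup fun x => H x y).mono
        fun x hx => hx.trans (hHw y)
    have h2 : ∀ᵐ x ∂μ, ∀ᵐ y ∂ν, H x y ≤ w y := by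
      rw [Measure.ae_ae_comm]
      · exact h1
      · exact measurableSet_le hH (hw.comp measurable_snd)
    filter_upwards [h2] with x hx
    exact lintegral_mono_ae hx
  · have h1 : 1 ≤ p.toReal := by simpa using ENNReal.toReal_mono hp' hp
    simp only [eLp_of_ne_top hp'] at hHw ⊢
    by_cases hwi : ∫⁻ y, w y ∂ν = ∞
    · simp [hwi]
    refine ENNReal.le_of_forall_pos_le_add fun ε hε _ => ?_
    obtain ⟨g, hg0, hgm, hgi⟩ := exists_pos_lintegral_lt_of_sigmaFinite ν
      (ENNReal.coe_ne_zero.2 hε.ne')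
    have hsum : ∫⁻ y, (w y + g y) ∂ν = ∫⁻ y, w y ∂ν + ∫⁻ y, g y ∂ν :=
      lintegral_add_left hw _
    calc _ ≤ ∫⁻ y, (w y + g y) ∂ν := by
          refine lintegral_rpow_lintegral_le_of_pos h1 hH (hw.add hgm.coe_nnreal_ennreal)
            (fun y => ?_) ?_ fun y => (hHw y).trans le_self_add
          · simp [(hg0 y).ne']
          · rw [hsum]
            exact ENNReal.add_ne_top.2 ⟨hwi, hgi.ne_top⟩
      _ ≤ _ := by
          rw [hsum]
          gcongr

end Lebesgue

section Young

variable {G : Type*} [AddCommGroup G] [MeasurableSpace G] [MeasurableAdd₂ G] [MeasurableNeg G]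
  {μ : Measure G} [μ.IsAddLeftInvariant] [μ.IsNegInvariant]

theorem lintegral_neg_add_eq_self (f : G → ℝ≥0∞) (x : G) :
    ∫⁻ y, f (-y + x) ∂μ = ∫⁻ y, f y ∂μ := by
  rw [← lintegral_neg_eq_self, ← lintegral_add_left_eq_self f x]
  simp [add_comm]

theorem lconvolution_le_mul_rpow {α β γ : ℝ} (hα : 0 < α) (hα1 : α ≤ 1) (hβ : 0 < β) (hβ1 : β ≤ 1)
    (hγ : 0 ≤ γ) (h : α + β = 1 + γ) {f g : G → ℝ≥0∞} (hf : Measurable f) (hg : Measurable g)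
    (x : G) :
    (f ⋆ₗ[μ] g) x ≤ ((fun y => f y ^ (1 / α)) ⋆ₗ[μ] (fun y => g y ^ (1 / β))) x ^ γ *
      ((∫⁻ y, f y ^ (1 / α) ∂μ) ^ (α - γ) * (∫⁻ y, g y ^ (1 / β) ∂μ) ^ (β - γ)) := by
  let F : Fin 3 → G → ℝ≥0∞ := ![fun y => f y ^ (1 / α) * g (-y + x) ^ (1 / β),
    fun y => f y ^ (1 / α), fun y => g (-y + x) ^ (1 / β)]
  let P : Fin 3 → ℝ := ![γ, α - γ, β - γ]
  have hgx : Measurable fun y => g (-y + x) := by fun_prop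
  have key := ENNReal.lintegral_prod_norm_pow_le (μ := μ) Finset.univ (f := F) (p := P)
    (by intro i _; fin_cases i <;> simp [F] <;> fun_prop)
    (by simp [Fin.sum_univ_three, P]; linarith)
    (by intro i _; fin_cases i <;> simp [P] <;> linarith)
  simp only [Fin.prod_univ_three, F, P, Matrix.cons_val_zero, Matrix.cons_val_one,
    Matrix.cons_val] at key
  rw [lintegral_neg_add_eq_self (fun y => g y ^ (1 / β)) x, mul_assoc] at key
  refine le_trans (le_of_eq (lintegral_congr fun y => ?_)) key
  have e1 : ∀ (a : ℝ≥0∞) (s : ℝ), 0 < s → 0 ≤ s - γ →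
      (a ^ (1 / s)) ^ γ * (a ^ (1 / s)) ^ (s - γ) = a := fun a s hs hsγ => by
    rw [← ENNReal.rpow_add_of_nonneg _ _ hγ hsγ, add_sub_cancel, ← ENNReal.rpow_mul,
      one_div_mul_cancel hs.ne', ENNReal.rpow_one]
  rw [ENNReal.mul_rpow_of_nonneg _ _ hγ]
  conv_lhs => rw [← e1 (f y) α hα (by linarith), ← e1 (g (-y + x)) β hβ (by linarith)]
  ring

/-- Young's convolution inequality with finite target exponent `1 / γ`. -/
theorem lintegral_lconvolution_rpow_le [SFinite μ] {α β γ : ℝ} (hα : 0 < α) (hα1 : α ≤ 1) (hβ : 0 < β)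
    (hβ1 : β ≤ 1) (hγ : 0 < γ) (h : α + β = 1 + γ) {f g : G → ℝ≥0∞} (hf : Measurable f)
    (hg : Measurable g) :
    (∫⁻ x, (f ⋆ₗ[μ] g) x ^ (1 / γ) ∂μ) ^ γ ≤
      (∫⁻ y, f y ^ (1 / α) ∂μ) ^ α * (∫⁻ y, g y ^ (1 / β) ∂μ) ^ β := by
  set A := ∫⁻ y, f y ^ (1 / α) ∂μ
  set B := ∫⁻ y, g y ^ (1 / β) ∂μ
  have hγ' : 0 ≤ 1 / γ := by positivity
  have hAB : ∫⁻ x, ((fun y => f y ^ (1 / α)) ⋆ₗ[μ] (fun y => g y ^ (1 / β))) x ∂μ = A * B := by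
    simp only [lconvolution_def]
    rw [lintegral_lintegral_swap (by fun_prop)]
    calc _ = ∫⁻ y, f y ^ (1 / α) * B ∂μ := by
          refine lintegral_congr fun y => ?_
          rw [lintegral_const_mul _ (by fun_prop),
            lintegral_add_left_eq_self (fun y => g y ^ (1 / β)) (-y)]
      _ = A * B := lintegral_mul_const _ (by fun_prop)
  have h1 : ∫⁻ x, (f ⋆ₗ[μ] g) x ^ (1 / γ) ∂μ ≤
      A * B * (A ^ (α - γ) * B ^ (β - γ)) ^ (1 / γ) := by
    rw [← hAB, ← lintegral_mul_const _ (by fun_prop)]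
    refine lintegral_mono fun x => ?_
    refine (ENNReal.rpow_le_rpow (lconvolution_le_mul_rpow hα hα1 hβ hβ1 hγ.le h hf hg x)
      hγ').trans (le_of_eq ?_)
    rw [ENNReal.mul_rpow_of_nonneg _ _ hγ', ← ENNReal.rpow_mul, mul_one_div_cancel hγ.ne',
      ENNReal.rpow_one]
  refine (ENNReal.rpow_le_rpow h1 hγ.le).trans (le_of_eq ?_)
  have e1 : ∀ (a : ℝ≥0∞) (s : ℝ), 0 ≤ s - γ → a ^ γ * a ^ (s - γ) = a ^ s := fun a s hs => by
    rw [← ENNReal.rpow_add_of_nonneg _ _ hγ.le hs, add_sub_cancel]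
  rw [ENNReal.mul_rpow_of_nonneg _ _ hγ.le, ENNReal.mul_rpow_of_nonneg _ _ hγ.le,
    ← ENNReal.rpow_mul, one_div_mul_cancel hγ.ne', ENNReal.rpow_one,
    ← e1 A α (by linarith), ← e1 B β (by linarith)]
  ring

/-- Young's convolution inequality. -/
theorem eLp_lconvolution_le [SFinite μ] {α β : ℝ} (hα : 0 < α) (hα1 : α ≤ 1) (hβ : 0 < β)
    (hβ1 : β ≤ 1) {r : ℝ≥0∞} (hr : 1 ≤ r) (h : α + β = 1 + r⁻¹.toReal) {f g : G → ℝ≥0∞}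
    (hf : Measurable f) (hg : Measurable g) :
    eLp r μ (f ⋆ₗ[μ] g) ≤
      (∫⁻ y, f y ^ (1 / α) ∂μ) ^ α * (∫⁻ y, g y ^ (1 / β) ∂μ) ^ β := by
  rcases eq_or_ne r ∞ with rfl | hr'
  · rw [eLp_top]
    refine essSup_le_of_ae_le _ (Eventually.of_forall fun x => ?_)
    simpa using lconvolution_le_mul_rpow (μ := μ) hα hα1 hβ hβ1 le_rfl (by simpa using h) hf hg x
  · have h0 : 0 < r.toReal := ENNReal.toReal_pos (by positivity) hr'
    rw [eLp_of_ne_top hr']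
    rw [ENNReal.toReal_inv] at h
    simpa using lintegral_lconvolution_rpow_le (μ := μ) hα hα1 hβ hβ1 (inv_pos.2 h0) h hf hg

end Young

open scoped FourierTransform Convolution

section Fourier

variable {E : Type*} [NormedAddCommGroup E] [InnerProductSpace ℝ E] [FiniteDimensional ℝ E]
  [MeasurableSpace E] [BorelSpace E]

/-- Continuous integrable functions with integrable Fourier transform. -/
structure FourierIntegrable (g : E → ℂ) : Prop where
  continuous : Continuous g
  integrable : Integrable g
  integrable_fourier : Integrable (𝓕 g)

theorem FourierIntegrable.exists_bound {g : E → ℂ} (hg : FourierIntegrable g) :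
    ∃ C, ∀ x, ‖g x‖ ≤ C := by
  refine ⟨∫ ξ, ‖𝓕 g ξ‖, fun x => ?_⟩
  rw [← congrFun (hg.continuous.fourierInv_fourier_eq hg.integrable hg.integrable_fourier) x,
    Real.fourierInv_eq]
  refine (norm_integral_le_integral_norm _).trans (le_of_eq ?_)
  simp

/-- The Fourier transform turns products into convolutions. -/
theorem FourierIntegrable.fourier_mul {g h : E → ℂ} (hg : FourierIntegrable g)
    (hh : Integrable h) (ξ : E) :
    𝓕 (fun y => g y * h y) ξ = ∫ η, 𝓕 g η * 𝓕 h (-η + ξ) := by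
  have hint : Integrable fun y => Real.fourierChar (-⟪y, ξ⟫) • h y :=
    (Real.fourierIntegral_convergent_iff ξ).2 hh
  have hinv : ∀ y, 𝓕 (𝓕 g) (-y) = g y := fun y => by
    rw [← Real.fourierInv_eq_fourier_neg]
    exact congrFun (hg.continuous.fourierInv_fourier_eq hg.integrable hg.integrable_fourier) y
  have key := VectorFourier.integral_fourierIntegral_smul_eq_flip (μ := volume) (ν := volume)
    (L := innerₗ E) (f := 𝓕 g) (g := fun y => Real.fourierChar (⟪y, ξ⟫) • h (-y))
    Real.continuous_fourierChar continuous_inner hg.integrable_fourier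
    (by simpa using hint.comp_neg)
  rw [Real.fourier_eq, ← integral_neg_eq_self]
  trans ∫ x, 𝓕 (𝓕 g) x • Real.fourierChar (⟪x, ξ⟫) • h (-x)
  · refine integral_congr_ae (ae_of_all _ fun y => ?_)
    simp only [← hinv, neg_neg, inner_neg_left, smul_eq_mul, Circle.smul_def]
    ring
  · refine key.trans (integral_congr_ae (ae_of_all _ fun η => ?_))
    simp only [smul_eq_mul]
    congr 1
    rw [Real.fourier_eq, ← integral_neg_eq_self]
    refine integral_congr_ae (ae_of_all _ fun y => ?_)
    simp only [neg_neg, LinearMap.flip_apply, innerₗ_apply_apply, smul_smul, inner_neg_left,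
      inner_add_right, inner_neg_right, real_inner_comm]
    rw [← AddChar.map_add_eq_mul]
    congr 2
    ring

theorem FourierIntegrable.mul {g h : E → ℂ} (hg : FourierIntegrable g)
    (hh : FourierIntegrable h) : FourierIntegrable fun y => g y * h y where
  continuous := hg.continuous.mul hh.continuous
  integrable := by
    obtain ⟨C, hC⟩ := hg.exists_bound
    exact hh.integrable.bdd_mul hg.continuous.aestronglyMeasurable (ae_of_all _ hC)
  integrable_fourier := by
    have := hg.integrable_fourier.integrable_convolution (ContinuousLinearMap.mul ℂ ℂ)
      hh.integrable_fourier
    refine this.congr (ae_of_all _ fun ξ => ?_)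
    simp only [hg.fourier_mul hh.integrable, convolution_def, ContinuousLinearMap.mul_apply']
    refine integral_congr_ae (ae_of_all _ fun η => ?_)
    simp [neg_add_eq_sub]

theorem SchwartzMap.fourierIntegrable (f : SchwartzMap E ℂ) : FourierIntegrable (f : E → ℂ) where
  continuous := f.continuous
  integrable := f.integrable
  integrable_fourier := by
    rw [← SchwartzMap.fourier_coe]
    exact (𝓕 f).integrable

theorem fourier_star (g : E → ℂ) (ξ : E) :
    𝓕 (fun y => starRingEnd ℂ (g y)) ξ = starRingEnd ℂ (𝓕 g (-ξ)) := by
  rw [Real.fourier_eq, Real.fourier_eq, ← integral_conj]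
  refine integral_congr_ae (ae_of_all _ fun y => ?_)
  simp [Circle.smul_def, ← Circle.coe_inv_eq_conj, AddChar.map_neg_eq_inv]

theorem FourierIntegrable.star {g : E → ℂ} (hg : FourierIntegrable g) :
    FourierIntegrable fun y => starRingEnd ℂ (g y) where
  continuous := Complex.continuous_conj.comp hg.continuous
  integrable := hg.integrable.congr' (by
    exact (Complex.continuous_conj.comp hg.continuous).aestronglyMeasurable) (by simp)
  integrable_fourier := by
    have h : Integrable fun ξ => 𝓕 g (-ξ) := hg.integrable_fourier.comp_neg
    refine (Complex.conjLIE.integrable_comp_iff.2 h).congr (ae_of_all _ fun ξ => ?_)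
    simp [fourier_star]

theorem integrable_gaussian {b : ℝ} (hb : 0 < b) (x : E) :
    Integrable fun y : E => Complex.exp (-((b * ‖y - x‖ ^ 2 : ℝ) : ℂ)) := by
  have h := (GaussianFourier.integrable_cexp_neg_mul_sq_norm_add (V := E) (b := b) (by simpa) 0
    0).comp_sub_right x
  simpa using h

theorem fourierIntegrable_gaussian {b : ℝ} (hb : 0 < b) (x : E) :
    FourierIntegrable fun y : E => Complex.exp (-((b * ‖y - x‖ ^ 2 : ℝ) : ℂ)) where
  continuous := by fun_prop
  integrable := integrable_gaussian hb x
  integrable_fourier := by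
    have h0 : Integrable (𝓕 fun y : E => Complex.exp (-((b * ‖y - 0‖ ^ 2 : ℝ) : ℂ))) := by
      have h1 : 0 < Real.pi ^ 2 / b := by positivity
      have h := (integrable_gaussian h1 (0 : E)).const_mul
        ((Real.pi / b : ℂ) ^ (Module.finrank ℝ E / 2 : ℂ))
      refine h.congr (ae_of_all _ fun ξ => ?_)
      have := fourier_gaussian_innerProductSpace (V := E) (b := b) (by simpa) ξ
      simp only [sub_zero]
      push_cast
      simp only [neg_mul] at this
      rw [this]
      congr 2
      ring
    have hs : ∀ ξ, Real.fourierChar (-⟪ξ, x⟫) •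
        𝓕 (fun y : E => Complex.exp (-((b * ‖y - 0‖ ^ 2 : ℝ) : ℂ))) ξ =
        𝓕 (fun y : E => Complex.exp (-((b * ‖y - x‖ ^ 2 : ℝ) : ℂ))) ξ := fun ξ => by
      have := congrFun (VectorFourier.fourierIntegral_comp_add_right Real.fourierChar volume
        (innerₗ E) (fun y : E => Complex.exp (-((b * ‖y - 0‖ ^ 2 : ℝ) : ℂ))) (-x)) ξ
      simp only [Function.comp_def, sub_zero, ← sub_eq_add_neg] at this ⊢
      rw [Real.fourier_eq, Real.fourier_eq]
      simp only [VectorFourier.fourierIntegral, innerₗ_apply_apply] at this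
      rw [this, inner_neg_left, real_inner_comm]
    exact ((Real.fourierIntegral_convergent_iff x).2 h0).congr (ae_of_all _ hs)

end Fourier

section GaussSTFT

variable {E : Type*} [NormedAddCommGroup E] [InnerProductSpace ℝ E] [FiniteDimensional ℝ E]
  [MeasurableSpace E] [BorelSpace E]

/-- Short-time Fourier transform with window `e^{-a|y|²}`. -/
def gaussSTFT (a : ℝ) (f : E → ℂ) (x ξ : E) : ℂ :=
  ∫ y : E, f y * Complex.exp (-((a * ‖y - x‖ ^ 2 : ℝ) : ℂ)) *
    Complex.exp (-Complex.I * (⟪y, ξ⟫ : ℝ))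

theorem gaussSTFT_eq_fourier (a : ℝ) (f : E → ℂ) (x ξ : E) :
    gaussSTFT a f x ξ =
      𝓕 (fun y => f y * Complex.exp (-((a * ‖y - x‖ ^ 2 : ℝ) : ℂ))) ((2 * Real.pi)⁻¹ • ξ) := by
  rw [Real.fourier_eq']
  refine integral_congr_ae (ae_of_all _ fun y => ?_)
  simp only [smul_eq_mul, inner_smul_right]
  rw [mul_comm]
  congr 2
  have : (Real.pi : ℂ) ≠ 0 := by exact_mod_cast Real.pi_ne_zero
  push_cast
  field_simp

theorem gaussSTFT_star (a : ℝ) (f : E → ℂ) (x ξ : E) :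
    gaussSTFT a (fun y => starRingEnd ℂ (f y)) x ξ = starRingEnd ℂ (gaussSTFT a f x (-ξ)) := by
  rw [gaussSTFT_eq_fourier, gaussSTFT_eq_fourier, smul_neg, ← fourier_star]
  refine congrFun (congrArg 𝓕 (funext fun y => ?_)) _
  rw [map_mul, ← Complex.exp_conj, map_neg, Complex.conj_ofReal]

theorem enorm_gaussSTFT_mul_le {a b : ℝ} {g h : E → ℂ} {x : E}
    (hg : FourierIntegrable fun y => g y * Complex.exp (-((a * ‖y - x‖ ^ 2 : ℝ) : ℂ)))
    (hh : Integrable fun y => h y * Complex.exp (-((b * ‖y - x‖ ^ 2 : ℝ) : ℂ))) (ξ : E) :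
    ‖gaussSTFT (a + b) (fun y => g y * h y) x ξ‖ₑ ≤
      ENNReal.ofReal ((2 * Real.pi)⁻¹ ^ Module.finrank ℝ E) *
        ((fun η => ‖gaussSTFT a g x η‖ₑ) ⋆ₗ (fun η => ‖gaussSTFT b h x η‖ₑ)) ξ := by
  have hs : (0 : ℝ) < (2 * Real.pi)⁻¹ := by positivity
  set s := (2 * Real.pi)⁻¹
  have h1 : gaussSTFT (a + b) (fun y => g y * h y) x ξ =
      ((s ^ Module.finrank ℝ E : ℝ) : ℂ) *
        ∫ η, gaussSTFT a g x η * gaussSTFT b h x (-η + ξ) := by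
    have h2 : (fun y => g y * h y * Complex.exp (-(((a + b) * ‖y - x‖ ^ 2 : ℝ) : ℂ))) =
        fun y => (g y * Complex.exp (-((a * ‖y - x‖ ^ 2 : ℝ) : ℂ))) *
          (h y * Complex.exp (-((b * ‖y - x‖ ^ 2 : ℝ) : ℂ))) := by
      ext y
      rw [add_mul, Complex.ofReal_add, neg_add, Complex.exp_add]
      ring
    rw [gaussSTFT_eq_fourier, h2, hg.fourier_mul hh]
    have h3 := Measure.integral_comp_smul (volume : Measure E) (fun η =>
      𝓕 (fun y => g y * Complex.exp (-((a * ‖y - x‖ ^ 2 : ℝ) : ℂ))) η *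
      𝓕 (fun y => h y * Complex.exp (-((b * ‖y - x‖ ^ 2 : ℝ) : ℂ))) (-η + s • ξ)) s
    simp only [← smul_neg, ← smul_add, s, ← gaussSTFT_eq_fourier] at h3
    rw [h3, abs_of_pos (by positivity), Complex.real_smul, ← mul_assoc, ← Complex.ofReal_mul,
      mul_inv_cancel₀ (by positivity), Complex.ofReal_one, one_mul]
  rw [h1, enorm_mul]
  refine mul_le_mul' (le_of_eq ?_) ?_
  · rw [← ofReal_norm, Complex.norm_real, Real.norm_of_nonneg (by positivity)]
  · refine (enorm_integral_le_lintegral_enorm _).trans (le_of_eq ?_)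
    simp only [lconvolution_def, enorm_mul]

theorem continuous_gaussSTFT {a : ℝ} (ha : 0 ≤ a) {f : E → ℂ} (hf : Integrable f) :
    Continuous fun z : E × E => gaussSTFT a f z.1 z.2 := by
  unfold gaussSTFT
  refine continuous_of_dominated (bound := fun y => ‖f y‖) (fun z => ?_) (fun z => ?_)
    hf.norm (ae_of_all _ fun y => by fun_prop)
  · exact (hf.1.mul (by fun_prop : Continuous _).aestronglyMeasurable).mul
      (by fun_prop : Continuous _).aestronglyMeasurable
  · refine ae_of_all _ fun y => ?_
    have e1 : ‖Complex.exp (-((a * ‖y - z.1‖ ^ 2 : ℝ) : ℂ))‖ ≤ 1 := by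
      rw [Complex.norm_exp, ← Complex.ofReal_neg, Complex.ofReal_re, Real.exp_le_one_iff]
      have : 0 ≤ a * ‖y - z.1‖ ^ 2 := by positivity
      linarith
    have e2 : ‖Complex.exp (-Complex.I * (⟪y, z.2⟫ : ℝ))‖ = 1 := by
      simp [Complex.norm_exp]
    rw [norm_mul, norm_mul, e2, mul_one]
    exact mul_le_of_le_one_right (norm_nonneg _) e1

theorem integral_gaussian_mul_gaussian {b : ℝ} (hb : 0 < b) (v : E) :
    ∫ u : E, Complex.exp (-((1 * ‖v - u‖ ^ 2 : ℝ) : ℂ)) * Complex.exp (-((b * ‖u‖ ^ 2 : ℝ) : ℂ)) =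
      ((∫ u : E, Real.exp (-(1 + b) * ‖u‖ ^ 2) : ℝ) : ℂ) *
        Complex.exp (-((b / (1 + b) * ‖v‖ ^ 2 : ℝ) : ℂ)) := by
  rw [← integral_add_right_eq_self _ ((1 + b)⁻¹ • v), ← integral_complex_ofReal, ← integral_mul_const]
  refine integral_congr_ae (ae_of_all _ fun u => ?_)
  simp only [Complex.ofReal_exp]
  rw [← Complex.exp_add, ← Complex.exp_add]
  congr 1
  norm_cast
  rw [norm_sub_sq_real, norm_add_sq_real, norm_smul, inner_smul_right, inner_add_right,
    inner_smul_right, real_inner_self_eq_norm_sq, real_inner_comm u v,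
    mul_pow, Real.norm_of_nonneg (by positivity)]
  field_simp
  ring

theorem mul_gaussSTFT_eq_integral {b : ℝ} (hb : 0 < b) {f : E → ℂ} (hf : Integrable f)
    (x ξ : E) :
    ((∫ u : E, Real.exp (-(1 + b) * ‖u‖ ^ 2) : ℝ) : ℂ) * gaussSTFT (b / (1 + b)) f x ξ =
      ∫ u : E, gaussSTFT 1 f (x + u) ξ * Complex.exp (-((b * ‖u‖ ^ 2 : ℝ) : ℂ)) := by
  have hG : Integrable fun u : E => Complex.exp (-((b * ‖u‖ ^ 2 : ℝ) : ℂ)) := by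
    simpa using integrable_gaussian hb (0 : E)
  simp only [gaussSTFT, ← integral_mul_const, ← integral_const_mul]
  rw [integral_integral_swap]
  · refine integral_congr_ae (ae_of_all _ fun y => ?_)
    calc _ = f y * Complex.exp (-Complex.I * (⟪y, ξ⟫ : ℝ)) *
          (((∫ u : E, Real.exp (-(1 + b) * ‖u‖ ^ 2) : ℝ) : ℂ) *
            Complex.exp (-((b / (1 + b) * ‖y - x‖ ^ 2 : ℝ) : ℂ))) := by ring
      _ = _ := by
        rw [← integral_gaussian_mul_gaussian hb, ← integral_const_mul]
        refine integral_congr_ae (ae_of_all _ fun u => ?_)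
        simp only [sub_sub]
        ring
  · have h1 := hG.mul_prod hf
    have h2 : Continuous fun z : E × E => Complex.exp (-((1 * ‖z.2 - (x + z.1)‖ ^ 2 : ℝ) : ℂ)) *
      Complex.exp (-Complex.I * (⟪z.2, ξ⟫ : ℝ)) := by fun_prop
    refine (h1.bdd_mul (c := 1) h2.aestronglyMeasurable (ae_of_all _ fun z => ?_)).congr
      (ae_of_all _ fun z => ?_)
    · rw [norm_mul, Complex.norm_exp, Complex.norm_exp, ← Complex.ofReal_neg, Complex.ofReal_re]
      simp
    · simp only [Function.uncurry]
      ring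

theorem enorm_gaussSTFT_le_lintegral {b : ℝ} (hb : 0 < b) {f : E → ℂ} (hf : Integrable f)
    (x ξ : E) :
    ‖gaussSTFT (b / (1 + b)) f x ξ‖ₑ ≤
      ENNReal.ofReal (∫ u : E, Real.exp (-(1 + b) * ‖u‖ ^ 2))⁻¹ *
        ∫⁻ u : E, ‖gaussSTFT 1 f (x + u) ξ‖ₑ * ENNReal.ofReal (Real.exp (-b * ‖u‖ ^ 2)) := by
  have hκ : 0 < ∫ u : E, Real.exp (-(1 + b) * ‖u‖ ^ 2) := by
    rw [GaussianFourier.integral_rexp_neg_mul_sq_norm (by positivity)]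
    positivity
  set κ := ∫ u : E, Real.exp (-(1 + b) * ‖u‖ ^ 2)
  have h1 : gaussSTFT (b / (1 + b)) f x ξ = ((κ⁻¹ : ℝ) : ℂ) *
      ∫ u : E, gaussSTFT 1 f (x + u) ξ * Complex.exp (-((b * ‖u‖ ^ 2 : ℝ) : ℂ)) := by
    rw [← mul_gaussSTFT_eq_integral hb hf, ← mul_assoc, ← Complex.ofReal_mul,
      inv_mul_cancel₀ hκ.ne', Complex.ofReal_one, one_mul]
  rw [h1, enorm_mul]
  refine mul_le_mul' (le_of_eq ?_) ?_
  · rw [← ofReal_norm, Complex.norm_real, Real.norm_of_nonneg (by positivity)]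
  · refine (enorm_integral_le_lintegral_enorm _).trans (le_of_eq ?_)
    refine lintegral_congr fun u => ?_
    rw [enorm_mul, ← ofReal_norm (Complex.exp _), Complex.norm_exp, ← Complex.ofReal_neg,
      Complex.ofReal_re, neg_mul]

end GaussSTFT

section Bernstein

theorem lintegral_mul_le_eLp {X : Type*} [MeasurableSpace X] {μ : Measure X} {p : ℝ≥0∞}
    (hp : 1 ≤ p) {u w : X → ℝ≥0∞} (hu : Measurable u) (hw : Measurable w) (hw1 : ∀ x, w x ≤ 1) :
    ∫⁻ x, u x * w x ∂μ ≤ max 1 (∫⁻ x, w x ∂μ) * eLp p μ u := by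
  rcases eq_or_ne p ∞ with rfl | hp'
  · rw [eLp_top]
    calc ∫⁻ x, u x * w x ∂μ ≤ ∫⁻ x, essSup u μ * w x ∂μ := by
          refine lintegral_mono_ae ((ENNReal.ae_le_essSup u).mono fun x hx => ?_)
          gcongr
      _ = (∫⁻ x, w x ∂μ) * essSup u μ := by rw [lintegral_const_mul _ hw, mul_comm]
      _ ≤ _ := by
          gcongr
          exact le_max_right _ _
  · have h1 : 1 ≤ p.toReal := by simpa using ENNReal.toReal_mono hp' hp
    have h0 : 0 < p.toReal := by linarith
    have h2 : 0 ≤ 1 - 1 / p.toReal := sub_nonneg.2 ((div_le_one h0).2 h1)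
    rw [eLp_of_ne_top hp', mul_comm]
    calc ∫⁻ x, u x * w x ∂μ
        = ∫⁻ x, (u x ^ p.toReal * w x) ^ (1 / p.toReal) * w x ^ (1 - 1 / p.toReal) ∂μ := by
          refine lintegral_congr fun x => ?_
          rw [ENNReal.mul_rpow_of_nonneg _ _ (by positivity), ← ENNReal.rpow_mul,
            mul_one_div_cancel h0.ne', ENNReal.rpow_one, mul_assoc,
            ← ENNReal.rpow_add_of_nonneg _ _ (by positivity) h2, add_sub_cancel, ENNReal.rpow_one]
      _ ≤ (∫⁻ x, u x ^ p.toReal * w x ∂μ) ^ (1 / p.toReal) *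
            (∫⁻ x, w x ∂μ) ^ (1 - 1 / p.toReal) :=
          ENNReal.lintegral_mul_norm_pow_le (by fun_prop) hw.aemeasurable (by positivity) h2
            (by ring)
      _ ≤ (∫⁻ x, u x ^ p.toReal ∂μ) ^ (1 / p.toReal) *
            max 1 (∫⁻ x, w x ∂μ) ^ (1 : ℝ) := by
          refine mul_le_mul' (ENNReal.rpow_le_rpow (lintegral_mono fun x => ?_) (by positivity)) ?_
          · exact mul_le_of_le_one_right' (hw1 x)
          · refine (ENNReal.rpow_le_rpow (le_max_right 1 _) h2).trans
              (ENNReal.rpow_le_rpow_of_exponent_le (le_max_left _ _) ?_)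
            have : 0 ≤ 1 / p.toReal := by positivity
            linarith
      _ = _ := by rw [ENNReal.rpow_one]

variable {E : Type*} [NormedAddCommGroup E] [InnerProductSpace ℝ E] [FiniteDimensional ℝ E]
  [MeasurableSpace E] [BorelSpace E]

theorem eLp_comp_add_le (p : ℝ≥0∞) (u : E → ℝ≥0∞) (v : E) :
    eLp p volume (fun x => u (x + v)) ≤ eLp p volume u := by
  rcases eq_or_ne p ∞ with rfl | hp'
  · rw [eLp_top, eLp_top]
    exact essSup_le_of_ae_le _ ((measurePreserving_add_right volume v).quasiMeasurePreserving.ae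
      (ENNReal.ae_le_essSup u))
  · rw [eLp_of_ne_top hp', eLp_of_ne_top hp',
      lintegral_add_right_eq_self (fun x => u x ^ p.toReal) v]

theorem measurable_eLp_of_continuous (p : ℝ≥0∞) {u : E → E → ℝ≥0∞}
    (hu : Continuous fun z : E × E => u z.1 z.2) :
    Measurable fun ξ => eLp p volume fun x => u x ξ := by
  rcases eq_or_ne p ∞ with rfl | hp'
  · have h : (fun ξ => eLp ∞ volume fun x => u x ξ) = fun ξ => ⨆ x, u x ξ := by
      ext ξ
      rw [eLp_top]
      have hc : Continuous fun x => u x ξ := hu.comp (by fun_prop : Continuous fun x => (x, ξ))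
      refine le_antisymm (essSup_le_of_ae_le _ (Eventually.of_forall fun x =>
        le_iSup (fun x => u x ξ) x)) (iSup_le fun x => ?_)
      have hd := (ENNReal.ae_le_essSup (μ := volume) fun x => u x ξ)
      have hd' := Measure.dense_of_ae hd
      exact (isClosed_le hc continuous_const).closure_subset_iff.2 (fun _ h => h) (hd' x)
    rw [h]
    exact (lowerSemicontinuous_iSup fun x =>
      (hu.comp (by fun_prop : Continuous fun ξ => (x, ξ))).lowerSemicontinuous).measurable
  · simp only [eLp_of_ne_top hp']
    exact (Measurable.lintegral_prod_left' (f := fun z : E × E => u z.1 z.2 ^ p.toReal)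
      (hu.measurable.pow_const _)).pow_const _

theorem lintegral_comp_add_mul_le {p : ℝ≥0∞} (hp : 1 ≤ p) {u w : E → ℝ≥0∞} (hu : Measurable u)
    (hw : Measurable w) (hw1 : ∀ x, w x ≤ 1) (x : E) :
    ∫⁻ v, u (x + v) * w v ≤ max 1 (∫⁻ v, w v) * eLp p volume u := by
  refine (lintegral_mul_le_eLp (u := fun v => u (x + v)) hp (by fun_prop) hw hw1).trans ?_
  gcongr
  simpa only [add_comm x] using eLp_comp_add_le p u x

theorem eLp_lintegral_comp_add_mul_le {p : ℝ≥0∞} (hp : 1 ≤ p) {u w : E → ℝ≥0∞}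
    (hu : Measurable u) (hw : Measurable w) :
    eLp p volume (fun x => ∫⁻ v, u (x + v) * w v) ≤ max 1 (∫⁻ v, w v) * eLp p volume u := by
  calc _ ≤ ∫⁻ v, w v * eLp p volume u := by
        refine eLp_lintegral_le hp (by fun_prop) (by fun_prop) fun v => ?_
        simp only [mul_comm _ (w v)]
        rw [eLp_const_mul hp (by fun_prop)]
        gcongr
        exact eLp_comp_add_le p u v
    _ = (∫⁻ v, w v) * eLp p volume u := lintegral_mul_const _ hw
    _ ≤ _ := by
        gcongr
        exact le_max_right _ _

theorem lintegral_gaussian_ne_top {b : ℝ} (hb : 0 < b) :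
    ∫⁻ u : E, ENNReal.ofReal (Real.exp (-b * ‖u‖ ^ 2)) ≠ ∞ := by
  rw [← ofReal_integral_eq_lintegral_ofReal]
  · exact ENNReal.ofReal_ne_top
  · refine (integrable_gaussian hb (0 : E)).norm.congr (ae_of_all _ fun u => ?_)
    simp only [Complex.norm_exp, ← Complex.ofReal_neg, Complex.ofReal_re, sub_zero, neg_mul]
  · exact ae_of_all _ fun u => (Real.exp_pos _).le

/-- Widening the Gaussian window is bounded from `L^p` to `L^∞` and from `L^p` to `L^p` in the
space variable. -/
theorem exists_gaussSTFT_le (E : Type*) [NormedAddCommGroup E] [InnerProductSpace ℝ E]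
    [FiniteDimensional ℝ E] [MeasurableSpace E] [BorelSpace E] {b : ℝ} (hb : 0 < b) {p : ℝ≥0∞}
    (hp : 1 ≤ p) :
    ∃ C : ℝ≥0∞, C ≠ ∞ ∧ ∀ f : E → ℂ, Integrable f → ∀ ξ : E,
      (∀ x, ‖gaussSTFT (b / (1 + b)) f x ξ‖ₑ ≤ C * eLp p volume fun x => ‖gaussSTFT 1 f x ξ‖ₑ) ∧
      eLp p volume (fun x => ‖gaussSTFT (b / (1 + b)) f x ξ‖ₑ) ≤
        C * eLp p volume fun x => ‖gaussSTFT 1 f x ξ‖ₑ := by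
  let G : E → ℝ≥0∞ := fun u => ENNReal.ofReal (Real.exp (-b * ‖u‖ ^ 2))
  have hGm : Measurable G := by fun_prop
  have hG1 : ∀ u, G u ≤ 1 := fun u => by
    rw [ENNReal.ofReal_le_one, Real.exp_le_one_iff]
    have : 0 ≤ b * ‖u‖ ^ 2 := by positivity
    linarith
  refine ⟨ENNReal.ofReal (∫ u : E, Real.exp (-(1 + b) * ‖u‖ ^ 2))⁻¹ * max 1 (∫⁻ u, G u),
    ENNReal.mul_ne_top ENNReal.ofReal_ne_top
      (max_lt ENNReal.one_lt_top (lintegral_gaussian_ne_top hb).lt_top).ne, fun f hf ξ => ?_⟩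
  have hm : Measurable fun x => ‖gaussSTFT 1 f x ξ‖ₑ :=
    ((continuous_gaussSTFT zero_le_one hf).enorm.comp
      (by fun_prop : Continuous fun x : E => (x, ξ))).measurable
  simp only [mul_assoc]
  refine ⟨fun x => (enorm_gaussSTFT_le_lintegral hb hf x ξ).trans ?_,
    (eLp_mono fun x => enorm_gaussSTFT_le_lintegral hb hf x ξ).trans ?_⟩
  · exact mul_le_mul_right (lintegral_comp_add_mul_le hp hm hGm hG1 x) _
  · rw [eLp_const_mul hp]
    · exact mul_le_mul_right (eLp_lintegral_comp_add_mul_le hp hm hGm) _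
    · exact Measurable.lintegral_prod_right'
        (f := fun z : E × E => ‖gaussSTFT 1 f (z.1 + z.2) ξ‖ₑ * G z.2)
        ((hm.comp (measurable_fst.add measurable_snd)).mul (hGm.comp measurable_snd))

end Bernstein

section Products

theorem lintegral_const_mul_rpow {X : Type*} [MeasurableSpace X] {μ : Measure X} {γ : ℝ}
    (hγ : 0 < γ) (c : ℝ≥0∞) {f : X → ℝ≥0∞} (hf : Measurable f) :
    (∫⁻ x, (c * f x) ^ (1 / γ) ∂μ) ^ γ = c * (∫⁻ x, f x ^ (1 / γ) ∂μ) ^ γ := by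
  simp_rw [ENNReal.mul_rpow_of_nonneg _ _ (one_div_pos.2 hγ).le]
  rw [lintegral_const_mul _ (by fun_prop), ENNReal.mul_rpow_of_nonneg _ _ hγ.le,
    ← ENNReal.rpow_mul, one_div_mul_cancel hγ.ne', ENNReal.rpow_one]

theorem lconvolution_mono {G : Type*} [AddGroup G] [MeasurableSpace G] {μ : Measure G}
    {f f' g g' : G → ℝ≥0∞} (hf : ∀ x, f x ≤ f' x) (hg : ∀ x, g x ≤ g' x) (x : G) :
    (f ⋆ₗ[μ] g) x ≤ (f' ⋆ₗ[μ] g') x :=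
  lintegral_mono fun y => mul_le_mul' (hf y) (hg _)

variable {E : Type*} [NormedAddCommGroup E] [InnerProductSpace ℝ E] [FiniteDimensional ℝ E]
  [MeasurableSpace E] [BorelSpace E]

theorem FourierIntegrable.prod {f : ℕ → E → ℂ} (hf : ∀ i, FourierIntegrable (f i)) (k : ℕ) :
    FourierIntegrable fun y => ∏ i ∈ Finset.range (k + 1), f i y := by
  induction k with
  | zero => simpa using hf 0
  | succ k ih =>
    simp only [Finset.prod_range_succ _ (k + 1)]
    exact ih.mul (hf _)

/-- The short-time Fourier transform of a product is dominated, uniformly in space, by an iterated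
convolution, which is controlled by Young's inequality. -/
theorem exists_gaussSTFT_prod_le {δ α : ℝ} (hδ : 0 < δ) (hα : 0 < α) (hα1 : α ≤ 1)
    {f : ℕ → E → ℂ} (hf : ∀ i, FourierIntegrable (f i)) {A : ℕ → E → ℝ≥0∞}
    (hAm : ∀ i, Measurable (A i)) (hA : ∀ i x ξ, ‖gaussSTFT δ (f i) x ξ‖ₑ ≤ A i ξ) {M : ℝ≥0∞}
    (hM : ∀ i, (∫⁻ ξ, A i ξ ^ (1 / α)) ^ α ≤ M) (k : ℕ) (hk : 0 < 1 - (k + 1) * (1 - α)) :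
    ∃ K : E → ℝ≥0∞, Measurable K ∧
      (∀ x ξ, ‖gaussSTFT ((k + 1) * δ) (fun y => ∏ i ∈ Finset.range (k + 1), f i y) x ξ‖ₑ ≤ K ξ) ∧
      (∫⁻ ξ, K ξ ^ (1 / (1 - (k + 1) * (1 - α)))) ^ (1 - (k + 1) * (1 - α)) ≤
        ENNReal.ofReal ((2 * Real.pi)⁻¹ ^ Module.finrank ℝ E) ^ k * M ^ (k + 1) := by
  set c := ENNReal.ofReal ((2 * Real.pi)⁻¹ ^ Module.finrank ℝ E)
  induction k with
  | zero => exact ⟨A 0, hAm 0, by simpa using hA 0, by simpa using hM 0⟩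
  | succ k ih =>
    push_cast at hk ⊢
    have hγ : 0 < 1 - ((k : ℝ) + 1) * (1 - α) := by nlinarith
    have hγ1 : 1 - ((k : ℝ) + 1) * (1 - α) ≤ 1 := by
      have : 0 ≤ ((k : ℝ) + 1) * (1 - α) := mul_nonneg (by positivity) (by linarith)
      linarith
    obtain ⟨K, hKm, hK, hKM⟩ := ih hγ
    refine ⟨fun ξ => c * (K ⋆ₗ A (k + 1)) ξ, by fun_prop, fun x ξ => ?_, ?_⟩
    · simp only [Finset.prod_range_succ _ (k + 1)]
      rw [add_mul _ 1 δ, one_mul]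
      refine (enorm_gaussSTFT_mul_le ((FourierIntegrable.prod hf k).mul
        (fourierIntegrable_gaussian (by positivity) x))
        ((hf _).mul (fourierIntegrable_gaussian hδ x)).integrable ξ).trans ?_
      gcongr
      exact lconvolution_mono (hK x) (hA _ x) ξ
    · rw [lintegral_const_mul_rpow hk _ (by fun_prop)]
      calc _ ≤ c * ((c ^ k * M ^ (k + 1)) * M) := by
            gcongr
            refine (lintegral_lconvolution_rpow_le hγ hγ1 hα hα1 hk (by ring) hKm
              (hAm _)).trans ?_
            exact mul_le_mul' hKM (hM _)
        _ = _ := by ring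

theorem prod_range_alternating_conj (z : ℂ) (k : ℕ) :
    ∏ i ∈ Finset.range (2 * k), (if Even i then z else starRingEnd ℂ z) =
      ((‖z‖ ^ (2 * k) : ℝ) : ℂ) := by
  induction k with
  | zero => simp
  | succ k ih =>
    rw [mul_add, mul_one, Finset.prod_range_succ, Finset.prod_range_succ, ih]
    simp only [even_two, Even.mul_right, if_true, Nat.even_add_one, not_true_eq_false, if_false]
    rw [mul_assoc, Complex.mul_conj, Complex.normSq_eq_norm_sq, ← Complex.ofReal_mul, ← pow_add]

theorem measurable_enorm_gaussSTFT {a : ℝ} (ha : 0 ≤ a) {f : E → ℂ} (hf : Integrable f)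
    {X : Type*} [MeasurableSpace X] {u v : X → E} (hu : Measurable u) (hv : Measurable v) :
    Measurable fun x => ‖gaussSTFT a f (u x) (v x)‖ₑ := by
  have h := (continuous_gaussSTFT ha hf).measurable.comp (hu.prodMk hv)
  simp only [Function.comp_def] at h
  exact h.enorm

/-- Mixed-norm bound for the short-time Fourier transform of a product, one factor of which is
controlled uniformly in space. -/
theorem eLp_gaussSTFT_mul_le {a δ : ℝ} (ha : 0 < a) (hδ : 0 < δ) {p : ℝ≥0∞} (hp : 1 ≤ p)
    {g f : E → ℂ} (hg : FourierIntegrable g) (hf : FourierIntegrable f) {K B : E → ℝ≥0∞}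
    (hKm : Measurable K) (hBm : Measurable B) (hK : ∀ x ξ, ‖gaussSTFT a g x ξ‖ₑ ≤ K ξ)
    (hB : ∀ ξ, eLp p volume (fun x => ‖gaussSTFT δ f x ξ‖ₑ) ≤ B ξ) (ξ : E) :
    eLp p volume (fun x => ‖gaussSTFT (a + δ) (fun y => g y * f y) x ξ‖ₑ) ≤
      ENNReal.ofReal ((2 * Real.pi)⁻¹ ^ Module.finrank ℝ E) * (K ⋆ₗ B) ξ := by
  have hm : Measurable (Function.uncurry fun x η => K η * ‖gaussSTFT δ f x (-η + ξ)‖ₑ) :=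
    (hKm.comp measurable_snd).mul (measurable_enorm_gaussSTFT hδ.le hf.integrable
      (u := fun z : E × E => z.1) (v := fun z : E × E => -z.2 + ξ) (by fun_prop) (by fun_prop))
  have hmul : ∀ x, ‖gaussSTFT (a + δ) (fun y => g y * f y) x ξ‖ₑ ≤
      ENNReal.ofReal ((2 * Real.pi)⁻¹ ^ Module.finrank ℝ E) *
        ∫⁻ η, K η * ‖gaussSTFT δ f x (-η + ξ)‖ₑ := fun x => by
    refine (enorm_gaussSTFT_mul_le (hg.mul (fourierIntegrable_gaussian ha x))
      (hf.mul (fourierIntegrable_gaussian hδ x)).integrable ξ).trans (mul_le_mul' le_rfl ?_)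
    exact lintegral_mono fun η => mul_le_mul' (hK x η) le_rfl
  have hint : eLp p volume (fun x => ∫⁻ η, K η * ‖gaussSTFT δ f x (-η + ξ)‖ₑ) ≤
      ∫⁻ η, K η * B (-η + ξ) := by
    refine eLp_lintegral_le hp hm (hKm.mul (hBm.comp (by fun_prop))) fun η => ?_
    have hη : Measurable fun x => ‖gaussSTFT δ f x (-η + ξ)‖ₑ :=
      measurable_enorm_gaussSTFT hδ.le hf.integrable (u := fun x => x) (v := fun _ => -η + ξ)
        measurable_id measurable_const
    exact (eLp_const_mul hp hη).trans_le (mul_le_mul' le_rfl (hB _))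
  refine (eLp_mono hmul).trans ?_
  have hm' := hm.lintegral_prod_right' (ν := volume)
  simp only [Function.uncurry_apply_pair] at hm'
  rw [eLp_const_mul hp hm', lconvolution_def]
  exact mul_le_mul' le_rfl hint

/-- Estimate for `|f|^{2β} f` with the exponents written through the reciprocals `α = 1/q` and
`r⁻¹`. -/
theorem exists_gaussSTFT_power_le (E : Type*) [NormedAddCommGroup E] [InnerProductSpace ℝ E]
    [FiniteDimensional ℝ E] [MeasurableSpace E] [BorelSpace E] {β : ℕ} (hβ : 1 ≤ β)
    {p r : ℝ≥0∞} (hp : 1 ≤ p) (hr : 1 ≤ r) {α : ℝ} (hα : 0 < α) (hα1 : α ≤ 1)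
    (h : r⁻¹.toReal + 2 * β = (2 * β + 1) * α) :
    ∃ C : ℝ≥0∞, C ≠ ∞ ∧ ∀ f : E → ℂ, FourierIntegrable f →
      eLp r volume (fun ξ => eLp p volume fun x =>
        ‖gaussSTFT 1 (fun y => ((‖f y‖ ^ (2 * β) : ℝ) : ℂ) * f y) x ξ‖ₑ) ≤
      C * ((∫⁻ ξ, (eLp p volume fun x => ‖gaussSTFT 1 f x ξ‖ₑ) ^ (1 / α)) ^ α) ^ (2 * β + 1) := by
  have hri : 0 ≤ r⁻¹.toReal := ENNReal.toReal_nonneg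
  obtain ⟨k, hk⟩ : ∃ k, 2 * β = k + 1 := ⟨2 * β - 1, by omega⟩
  have hkβ : (k : ℝ) + 1 = 2 * β := by exact_mod_cast hk.symm
  have hβ' : (1 : ℝ) ≤ β := by exact_mod_cast hβ
  have hγ : 0 < 1 - ((k : ℝ) + 1) * (1 - α) := by
    rw [hkβ]
    nlinarith
  have hγ1 : 1 - ((k : ℝ) + 1) * (1 - α) ≤ 1 := by
    have : 0 ≤ ((k : ℝ) + 1) * (1 - α) := mul_nonneg (by positivity) (by linarith)
    linarith
  obtain ⟨C, hCt, hC⟩ := exists_gaussSTFT_le E (b := 1 / (2 * β : ℝ)) (by positivity) hp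
  obtain ⟨δ, hδ0, hδ, hδ1⟩ : ∃ δ : ℝ, 0 < δ ∧
      1 / (2 * β : ℝ) / (1 + 1 / (2 * β : ℝ)) = δ ∧ 2 * (β : ℝ) * δ + δ = 1 :=
    ⟨1 / (2 * β + 1), by positivity, by field_simp, by field_simp⟩
  rw [hδ] at hC
  refine ⟨ENNReal.ofReal ((2 * Real.pi)⁻¹ ^ Module.finrank ℝ E) ^ (k + 1) * C ^ (2 * β + 1),
    ENNReal.mul_ne_top (ENNReal.pow_ne_top ENNReal.ofReal_ne_top) (ENNReal.pow_ne_top hCt),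
    fun f hf => ?_⟩
  obtain ⟨a, ha⟩ : ∃ a : E → ℝ≥0∞, a = fun ξ => eLp p volume fun x => ‖gaussSTFT 1 f x ξ‖ₑ :=
    ⟨_, rfl⟩
  have ham : Measurable a := ha ▸
    measurable_eLp_of_continuous p (continuous_gaussSTFT zero_le_one hf.integrable).enorm
  have haC : ∀ ξ, (∀ x, ‖gaussSTFT δ f x ξ‖ₑ ≤ C * a ξ) ∧
      eLp p volume (fun x => ‖gaussSTFT δ f x ξ‖ₑ) ≤ C * a ξ := by
    rw [ha]
    exact hC f hf.integrable
  simp only [← congrFun ha]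
  have hCa := (lintegral_const_mul_rpow (μ := volume) hα C ham).le
  have hff : ∀ i : ℕ, FourierIntegrable fun y => if Even i then f y else starRingEnd ℂ (f y) :=
    fun i => by by_cases hi : Even i <;> simp only [hi, if_true, if_false]; exacts [hf, hf.star]
  obtain ⟨K, hKm, hK, hKM⟩ := exists_gaussSTFT_prod_le hδ0 hα hα1 hff
    (A := fun i ξ => C * a (if Even i then ξ else -ξ))
    (fun i => by by_cases hi : Even i <;> simp only [hi, if_true, if_false] <;> fun_prop)
    (fun i x ξ => by
      by_cases hi : Even i <;> simp only [hi, if_true, if_false]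
      · exact (haC ξ).1 x
      · rw [gaussSTFT_star, RCLike.enorm_conj]
        exact (haC (-ξ)).1 x)
    (fun i => by
      by_cases hi : Even i <;> simp only [hi, if_true, if_false]
      · exact hCa
      · rw [lintegral_neg_eq_self (fun ξ => (C * a ξ) ^ (1 / α))]
        exact hCa) k hγ
  have hP := FourierIntegrable.prod hff k
  simp only [← hk, prod_range_alternating_conj, hkβ] at hK hP
  have hpt := eLp_gaussSTFT_mul_le (by positivity) hδ0 hp hP hf hKm (ham.const_mul C) hK
    (fun ξ => (haC ξ).2)
  rw [hδ1] at hpt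
  calc _ ≤ eLp r volume (fun ξ => ENNReal.ofReal ((2 * Real.pi)⁻¹ ^ Module.finrank ℝ E) *
          (K ⋆ₗ fun η => C * a η) ξ) := eLp_mono hpt
    _ = ENNReal.ofReal ((2 * Real.pi)⁻¹ ^ Module.finrank ℝ E) *
          eLp r volume (K ⋆ₗ fun η => C * a η) := eLp_const_mul hr (by fun_prop)
    _ ≤ _ := mul_le_mul' le_rfl ((eLp_lconvolution_le hγ hγ1 hα hα1 hr (by rw [hkβ]; linarith) hKm
        (ham.const_mul C)).trans (mul_le_mul' hKM hCa))
    _ = _ := by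
        rw [hk]
        ring

end Products

theorem modNorm_eq (n : ℕ) (p q : ℝ≥0∞) (f : EuclideanSpace ℝ (Fin n) → ℂ) :
    modNorm n p q f = eLp q volume fun ξ => eLp p volume fun x => ‖gaussSTFT 1 f x ξ‖ₑ := by
  simp only [modNorm, STFT, gaussSTFT, one_mul, ofReal_norm]

/-- **Multilinear estimate for the power nonlinearity on modulation spaces.** If
`1/r + 2β = (2β+1)/q` then `‖|f|^{2β} f‖_{M^{p,r}} ≤ C ‖f‖_{M^{p,q}}^{2β+1}`. -/
theorem modulation_power_nonlinearity_estimate (n β : ℕ) (hn : 1 ≤ n) (hβ : 1 ≤ β)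
    (p q r : ℝ≥0∞) (hp : 1 ≤ p) (hq : 1 ≤ q) (hr : 1 ≤ r)
    (hcond : 1 / r + (2 * β : ℕ) = ((2 * β + 1 : ℕ) : ℝ≥0∞) / q) :
    ∃ C : ℝ, 0 < C ∧ ∀ f : SchwartzMap (EuclideanSpace ℝ (Fin n)) ℂ,
      modNorm n p r (fun y => ((‖f y‖ ^ (2 * β) : ℝ) : ℂ) * f y) ≤
        ENNReal.ofReal C * modNorm n p q (fun y => f y) ^ (2 * β + 1) := by
  have hr0 : r ≠ 0 := (zero_lt_one.trans_le hr).ne'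
  have hqt : q ≠ ∞ := by
    rintro rfl
    rw [ENNReal.div_top, add_eq_zero] at hcond
    have : 2 * β = 0 := by exact_mod_cast hcond.2
    omega
  have hqr : 1 ≤ q.toReal := by simpa using ENNReal.toReal_mono hqt hq
  have hcond' : r⁻¹.toReal + 2 * β = (2 * β + 1) * (1 / q.toReal) := by
    have := congrArg ENNReal.toReal hcond
    rw [ENNReal.toReal_add (by simp [hr0]) (ENNReal.natCast_ne_top _), ENNReal.toReal_div,
      ENNReal.toReal_div, ENNReal.toReal_natCast, ENNReal.toReal_natCast] at this
    simpa [div_eq_mul_inv] using this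
  obtain ⟨C, hCt, hC⟩ := exists_gaussSTFT_power_le (EuclideanSpace ℝ (Fin n)) hβ hp hr
    (by positivity) ((div_le_one (by linarith)).2 hqr) hcond'
  refine ⟨C.toReal + 1, by positivity, fun f => ?_⟩
  rw [modNorm_eq, modNorm_eq, eLp_of_ne_top hqt]
  refine (hC f (SchwartzMap.fourierIntegrable f)).trans ?_
  rw [one_div_one_div]
  refine mul_le_mul' ?_ le_rfl
  rw [ENNReal.ofReal_add ENNReal.toReal_nonneg zero_le_one, ENNReal.ofReal_toReal hCt]
  exact le_self_add
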